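/- arXiv:1809.09991 — 2 statements merged into one kernel-verified Lean document; each statement's English description precedes it below -/
import Mathlib

section
/- Let a < b be real numbers and let h ∈ AP(a,b). Then Γ_h = {(x,y) ∈ ℝ² : a < x < b, h(x) ≤ y ≤ h⁺(x)}, where h⁺(x) := limsup_{z→x} h(z). -/
open MeasureTheory Topology Filter Set

/-- The subgraph `Ω_h = {(x,y) : a < x < b, y < h x}`. -/
def filmSubgraph (a b : ℝ) (h : ℝ → ℝ) : Set (EuclideanSpace ℝ (Fin 2)) :=
  {p | a < p 0 ∧ p 0 < b ∧ p 1 < h (p 0)}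

/-- The vertical strip `(a,b) × ℝ`. -/
def filmStrip (a b : ℝ) : Set (EuclideanSpace ℝ (Fin 2)) :=
  {p | a < p 0 ∧ p 0 < b}

/-- The graph `Γ_h = ∂Ω_h ∩ ((a,b) × ℝ)`. -/
def filmGraph (a b : ℝ) (h : ℝ → ℝ) : Set (EuclideanSpace ℝ (Fin 2)) :=
  frontier (filmSubgraph a b h) ∩ filmStrip a b

/-- `h⁺(x) = limsup_{z → x} h(z)`. -/
noncomputable def hPlus (h : ℝ → ℝ) (x : ℝ) : ℝ :=
  Filter.limsup h (𝓝[≠] x)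

/-- A lower semicontinuous function on `[a,b]` has an open subgraph over `(a,b)`. -/
lemma isOpen_filmSubgraph {a b : ℝ} {h : ℝ → ℝ}
    (hlsc : LowerSemicontinuousOn h (Set.Icc a b)) : IsOpen (filmSubgraph a b h) := by
  rw [isOpen_iff_mem_nhds]
  rintro p ⟨ha, hb, hp⟩
  obtain ⟨c, hc, hch⟩ := exists_between hp
  have hx := hlsc (p 0) ⟨ha.le, hb.le⟩ c hch
  rw [nhdsWithin_eq_nhds.2 (Icc_mem_nhds ha hb)] at hx
  have h0 : Tendsto (fun q : EuclideanSpace ℝ (Fin 2) => q 0) (𝓝 p) (𝓝 (p 0)) :=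
    Continuous.tendsto (by fun_prop) p
  have h1 : Tendsto (fun q : EuclideanSpace ℝ (Fin 2) => q 1) (𝓝 p) (𝓝 (p 1)) :=
    Continuous.tendsto (by fun_prop) p
  filter_upwards [h0.eventually hx, h0.eventually (lt_mem_nhds ha),
    h0.eventually (gt_mem_nhds hb), h1.eventually (gt_mem_nhds hc)] with q hq hqa hqb hqc
  exact ⟨hqa, hqb, hqc.trans hq⟩

/-- A function of bounded variation on `[a,b]` is bounded above near points of `(a,b)`. -/
lemma isBoundedUnder_le_of_boundedVariationOn {a b x : ℝ} {h : ℝ → ℝ} (ha : a < x) (hb : x < b)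
    (hbv : BoundedVariationOn h (Set.Icc a b)) :
    IsBoundedUnder (· ≤ ·) (𝓝[≠] x) h := by
  refine isBoundedUnder_of_eventually_le (a := h x + (eVariationOn h (Set.Icc a b)).toReal) ?_
  filter_upwards [mem_nhdsWithin_of_mem_nhds (Icc_mem_nhds ha hb)] with z hz
  linarith [hbv.sub_le hz (⟨ha.le, hb.le⟩ : x ∈ Set.Icc a b)]

/-- A function that is nonnegative on `[a,b]` is cobounded near points of `(a,b)`. -/
lemma isCoboundedUnder_le_of_nonneg {a b x : ℝ} {h : ℝ → ℝ} (ha : a < x) (hb : x < b)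
    (hnn : ∀ x ∈ Set.Icc a b, 0 ≤ h x) :
    IsCoboundedUnder (· ≤ ·) (𝓝[≠] x) h := by
  refine IsBoundedUnder.isCoboundedUnder_le (isBoundedUnder_of_eventually_ge (a := 0) ?_)
  filter_upwards [mem_nhdsWithin_of_mem_nhds (Icc_mem_nhds ha hb)] with z hz
  exact hnn z hz

/-- Lower semicontinuity gives `h x ≤ h⁺ x`. -/
lemma le_hPlus {a b x : ℝ} {h : ℝ → ℝ} (ha : a < x) (hb : x < b)
    (hlsc : LowerSemicontinuousOn h (Set.Icc a b))
    (hbv : BoundedVariationOn h (Set.Icc a b)) : h x ≤ hPlus h x := by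
  refine le_of_forall_lt fun c hc => ?_
  obtain ⟨d, hcd, hd⟩ := exists_between hc
  have hx := hlsc x ⟨ha.le, hb.le⟩ d hd
  rw [nhdsWithin_eq_nhds.2 (Icc_mem_nhds ha hb)] at hx
  refine hcd.trans_le (le_limsup_of_frequently_le ?_
    (isBoundedUnder_le_of_boundedVariationOn ha hb hbv))
  exact ((hx.filter_mono nhdsWithin_le_nhds).mono fun _ hz => hz.le).frequently

/-- Over `(a,b)`, the closure of the subgraph of `h` is the closed subgraph of `h⁺`. -/
lemma mem_closure_filmSubgraph_iff {a b : ℝ} {h : ℝ → ℝ} {p : EuclideanSpace ℝ (Fin 2)}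
    (ha : a < p 0) (hb : p 0 < b)
    (hlsc : LowerSemicontinuousOn h (Set.Icc a b))
    (hnn : ∀ x ∈ Set.Icc a b, 0 ≤ h x)
    (hbv : BoundedVariationOn h (Set.Icc a b)) :
    p ∈ closure (filmSubgraph a b h) ↔ p 1 ≤ hPlus h (p 0) := by
  constructor
  · intro hp
    by_contra! hlt
    obtain ⟨c, hc, hcp⟩ := exists_between hlt
    have hx : ∀ᶠ z in 𝓝[≠] (p 0), h z < c :=
      eventually_lt_of_limsup_lt hc (isBoundedUnder_le_of_boundedVariationOn ha hb hbv)
    have hx' : ∀ᶠ z in 𝓝 (p 0), h z < c := by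
      filter_upwards [eventually_nhdsWithin_iff.1 hx] with z hz
      by_cases hzp : z = p 0
      · exact hzp ▸ (le_hPlus ha hb hlsc hbv).trans_lt hc
      · exact hz hzp
    have h0 : Tendsto (fun q : EuclideanSpace ℝ (Fin 2) => q 0) (𝓝 p) (𝓝 (p 0)) :=
      Continuous.tendsto (by fun_prop) p
    have h1 : Tendsto (fun q : EuclideanSpace ℝ (Fin 2) => q 1) (𝓝 p) (𝓝 (p 1)) :=
      Continuous.tendsto (by fun_prop) p
    obtain ⟨q, ⟨-, -, hq⟩, hq0, hq1⟩ := ((mem_closure_iff_frequently.1 hp).and_eventually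
      ((h0.eventually hx').and (h1.eventually (lt_mem_nhds hcp)))).exists
    exact (hq1.trans hq).not_gt hq0
  · intro hp
    have hf : Continuous fun z : ℝ × ℝ => (!₂[z.1, z.2] : EuclideanSpace ℝ (Fin 2)) := by
      fun_prop
    have hpe : p = !₂[p 0, p 1] := by
      ext i
      fin_cases i <;> simp
    rw [hpe]
    refine map_mem_closure (s := {z : ℝ × ℝ | a < z.1 ∧ z.1 < b ∧ z.2 < h z.1})
      (x := (p 0, p 1)) hf ?_ fun z hz => by simpa [filmSubgraph] using hz
    rw [Metric.mem_closure_iff]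
    intro ε hε
    have hfr : ∃ᶠ z in 𝓝[≠] (p 0), p 1 - ε / 2 < h z :=
      frequently_lt_of_lt_limsup (isCoboundedUnder_le_of_nonneg ha hb hnn)
        (lt_of_lt_of_le (by linarith) hp)
    obtain ⟨z, hz, hzs, hzε⟩ := (hfr.and_eventually
      ((eventually_nhdsWithin_of_eventually_nhds (Ioo_mem_nhds ha hb)).and
        (eventually_nhdsWithin_of_eventually_nhds (Metric.ball_mem_nhds (p 0) hε)))).exists
    refine ⟨(z, p 1 - ε / 2), ⟨hzs.1, hzs.2, hz⟩, ?_⟩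
    rw [Prod.dist_eq, max_lt_iff]
    refine ⟨by simpa [dist_comm] using hzε, ?_⟩
    rw [Real.dist_eq, abs_lt]
    constructor <;> simp only [sub_sub_cancel] <;> linarith

/-- For `h ∈ AP(a,b)`,
`Γ_h = {(x,y) : a < x < b, h(x) ≤ y ≤ h⁺(x)}` where `h⁺(x) = limsup_{z→x} h(z)`. -/
theorem filmGraph_eq
    (a b : ℝ) (hab : a < b) (h : ℝ → ℝ)
    (hlsc : LowerSemicontinuousOn h (Set.Icc a b))
    (hnn : ∀ x ∈ Set.Icc a b, 0 ≤ h x)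
    (hbv : BoundedVariationOn h (Set.Icc a b)) :
    filmGraph a b h
      = {p : EuclideanSpace ℝ (Fin 2) |
          a < p 0 ∧ p 0 < b ∧ h (p 0) ≤ p 1 ∧ p 1 ≤ hPlus h (p 0)} := by
  ext p
  rw [filmGraph, (isOpen_filmSubgraph hlsc).frontier_eq]
  constructor
  · rintro ⟨⟨hcl, hn⟩, ha, hb⟩
    exact ⟨ha, hb, not_lt.1 fun hlt => hn ⟨ha, hb, hlt⟩,
      (mem_closure_filmSubgraph_iff ha hb hlsc hnn hbv).1 hcl⟩
  · rintro ⟨ha, hb, hle, hp⟩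
    exact ⟨⟨(mem_closure_filmSubgraph_iff ha hb hlsc hnn hbv).2 hp,
      fun hq => hle.not_gt hq.2.2⟩, ha, hb⟩
end

section
/- Let a < b be real numbers and let h ∈ AP(a,b). Then Γ̃_h = {(x,y) ∈ ℝ² : a < x < b, h⁻(x) ≤ y ≤ h⁺(x)}, where h⁻(x) := liminf_{z→x} h(z) and h⁺(x) := limsup_{z→x} h(z). -/
open MeasureTheory Topology Filter Set

/-- `Γ̃_h = ∂(cl Ω_h) ∩ ((a,b) × ℝ)`. -/
def filmGraphTilde (a b : ℝ) (h : ℝ → ℝ) : Set (EuclideanSpace ℝ (Fin 2)) :=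
  frontier (closure (filmSubgraph a b h)) ∩ filmStrip a b

/-- `h⁻(x) = liminf_{z → x} h(z)`. -/
noncomputable def hMinus (h : ℝ → ℝ) (x : ℝ) : ℝ :=
  Filter.liminf h (𝓝[≠] x)

/-- A function with limits along two filters has upper limit along their supremum equal to the
maximum of the two limits. -/
lemma limsup_sup_of_tendsto {ι α : Type*} [ConditionallyCompleteLinearOrder α]
    [TopologicalSpace α] [OrderTopology α] [DenselyOrdered α] {f g : Filter ι} [f.NeBot] [g.NeBot]
    {u : ι → α} {l r : α} (hl : Tendsto u f (𝓝 l)) (hr : Tendsto u g (𝓝 r)) :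
    limsup u (f ⊔ g) = max l r := by
  have hle : (f ⊔ g).IsBoundedUnder (· ≤ ·) u := by
    obtain ⟨b, hb⟩ := hl.isBoundedUnder_le
    obtain ⟨c, hc⟩ := hr.isBoundedUnder_le
    simp only [eventually_map] at hb hc
    refine ⟨max b c, ?_⟩
    simp only [eventually_map, eventually_sup]
    exact ⟨hb.mono fun _ h => h.trans (le_max_left _ _),
      hc.mono fun _ h => h.trans (le_max_right _ _)⟩
  have hco : (f ⊔ g).IsCoboundedUnder (· ≤ ·) u := by
    obtain ⟨b, hb⟩ := hl.isCoboundedUnder_le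
    exact ⟨b, fun c hc => hb c (hc.filter_mono (map_mono le_sup_left))⟩
  refine le_antisymm ?_ (max_le ?_ ?_)
  · rw [limsup_le_iff hco hle]
    intro y hy
    rw [eventually_sup]
    exact ⟨hl.eventually_lt_const ((le_max_left _ _).trans_lt hy),
      hr.eventually_lt_const ((le_max_right _ _).trans_lt hy)⟩
  · rw [← hl.limsup_eq]
    exact limsup_le_limsup_of_le le_sup_left hl.isCoboundedUnder_le hle
  · rw [← hr.limsup_eq]
    exact limsup_le_limsup_of_le le_sup_right hr.isCoboundedUnder_le hle

lemma liminf_sup_of_tendsto {ι α : Type*} [ConditionallyCompleteLinearOrder α]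
    [TopologicalSpace α] [OrderTopology α] [DenselyOrdered α] {f g : Filter ι} [f.NeBot] [g.NeBot]
    {u : ι → α} {l r : α} (hl : Tendsto u f (𝓝 l)) (hr : Tendsto u g (𝓝 r)) :
    liminf u (f ⊔ g) = min l r :=
  limsup_sup_of_tendsto (α := αᵒᵈ) hl hr

lemma hPlus_eq_max {h : ℝ → ℝ} {x l r : ℝ} (hl : Tendsto h (𝓝[<] x) (𝓝 l))
    (hr : Tendsto h (𝓝[>] x) (𝓝 r)) : hPlus h x = max l r := by
  rw [hPlus, ← nhdsLT_sup_nhdsGT, limsup_sup_of_tendsto hl hr]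

lemma hMinus_eq_min {h : ℝ → ℝ} {x l r : ℝ} (hl : Tendsto h (𝓝[<] x) (𝓝 l))
    (hr : Tendsto h (𝓝[>] x) (𝓝 r)) : hMinus h x = min l r := by
  rw [hMinus, ← nhdsLT_sup_nhdsGT, liminf_sup_of_tendsto hl hr]

lemma tendsto_vec_two {ι : Type*} {F : Filter ι} {u v : ι → ℝ} {p : EuclideanSpace ℝ (Fin 2)}
    (hu : Tendsto u F (𝓝 (p 0))) (hv : Tendsto v F (𝓝 (p 1))) :
    Tendsto (fun i => !₂[u i, v i]) F (𝓝 p) := by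
  have hp : p = WithLp.toLp 2 p.ofLp := rfl
  rw [hp]
  refine ((PiLp.continuous_toLp 2 _).tendsto _).comp (tendsto_pi_nhds.2 fun j => ?_)
  fin_cases j
  · simpa using hu
  · simpa using hv

lemma tendsto_coord (p : EuclideanSpace ℝ (Fin 2)) (j : Fin 2) :
    Tendsto (fun q : EuclideanSpace ℝ (Fin 2) => q j) (𝓝 p) (𝓝 (p j)) :=
  (by fun_prop : Continuous fun q : EuclideanSpace ℝ (Fin 2) => q j).tendsto p

/-- Points lying strictly above the graph are outside the closed subgraph. -/
lemma notMem_closure_filmSubgraph {a b c : ℝ} {h : ℝ → ℝ} {p : EuclideanSpace ℝ (Fin 2)}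
    (hc : ∀ᶠ z in 𝓝 (p 0), h z < c) (hp : c < p 1) : p ∉ closure (filmSubgraph a b h) := by
  intro hmem
  rw [mem_closure_iff_frequently] at hmem
  refine hmem ?_
  filter_upwards [(tendsto_coord p 0).eventually hc, (tendsto_coord p 1).eventually_const_lt hp]
    with q hq hq' hΩ
  exact (hΩ.2.2.trans hq).not_gt hq'

/-- Points below a limit of `h` at `p 0` lie in the closed subgraph. -/
lemma mem_closure_filmSubgraph {a b l : ℝ} {h : ℝ → ℝ} {p : EuclideanSpace ℝ (Fin 2)} {s : Set ℝ}
    [(𝓝[s] p 0).NeBot] (hs : p 0 ∉ s) (ha : a < p 0) (hb : p 0 < b)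
    (hl : Tendsto h (𝓝[s] p 0) (𝓝 l)) (hp : p 1 ≤ l) : p ∈ closure (filmSubgraph a b h) := by
  have hid : Tendsto (fun z : ℝ => z) (𝓝[s] p 0) (𝓝 (p 0)) := tendsto_id.mono_left inf_le_left
  have hlim : Tendsto (fun z => p 1 - (l - h z) - |p 0 - z|) (𝓝[s] p 0) (𝓝 (p 1)) := by
    have := ((hl.const_sub l).const_sub (p 1)).sub (hid.const_sub (p 0)).abs
    simpa using this
  refine mem_closure_of_tendsto (tendsto_vec_two hid hlim) ?_
  filter_upwards [hid.eventually_const_lt ha, hid.eventually_lt_const hb, self_mem_nhdsWithin]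
    with z hza hzb hzs
  have hne : p 0 ≠ z := fun h => hs (h ▸ hzs)
  have hpos : 0 < |p 0 - z| := abs_pos.2 (sub_ne_zero.2 hne)
  refine ⟨by simpa using hza, by simpa using hzb, ?_⟩
  simp only [Matrix.cons_val_zero, Matrix.cons_val_one]
  linarith

/-- A point at or above a one-sided limit of `h` is not interior to the closed subgraph. -/
lemma lt_of_mem_interior_closure_filmSubgraph {a b l : ℝ} {h : ℝ → ℝ}
    {p : EuclideanSpace ℝ (Fin 2)} {s : Set ℝ} (hs : IsOpen s) [(𝓝[s] p 0).NeBot]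
    (hl : Tendsto h (𝓝[s] p 0) (𝓝 l)) (hp : p ∈ interior (closure (filmSubgraph a b h))) :
    p 1 < l := by
  by_contra! hle
  have hvert : Tendsto (fun y : ℝ => !₂[p 0, y]) (𝓝[>] p 1) (𝓝 p) :=
    tendsto_vec_two tendsto_const_nhds (tendsto_id.mono_left inf_le_left)
  obtain ⟨y, hy, hpy⟩ := ((hvert.eventually (isOpen_interior.mem_nhds hp)).and
    self_mem_nhdsWithin).exists
  have hhor : Tendsto (fun z : ℝ => !₂[z, y]) (𝓝[s] p 0) (𝓝 !₂[p 0, y]) :=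
    tendsto_vec_two (tendsto_id.mono_left nhdsWithin_le_nhds) (by simp)
  obtain ⟨c, hlc, hcy⟩ := exists_between (hle.trans_lt hpy)
  obtain ⟨z, ⟨hz, hzc⟩, hzs⟩ := (((hhor.eventually (isOpen_interior.mem_nhds hy)).and
    (eventually_eventually_nhdsWithin.2 (hl.eventually_lt_const hlc))).and
    self_mem_nhdsWithin).exists
  rw [hs.nhdsWithin_eq hzs] at hzc
  exact notMem_closure_filmSubgraph (by simpa using hzc) (by simpa using hcy)
    (interior_subset hz)

lemma mem_closure_filmSubgraph_iff_s3 {a b l r : ℝ} {h : ℝ → ℝ} {p : EuclideanSpace ℝ (Fin 2)}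
    (ha : a < p 0) (hb : p 0 < b) (hl : Tendsto h (𝓝[<] p 0) (𝓝 l))
    (hr : Tendsto h (𝓝[>] p 0) (𝓝 r)) (hmax : h (p 0) ≤ max l r) :
    p ∈ closure (filmSubgraph a b h) ↔ p 1 ≤ max l r := by
  refine ⟨fun hp => ?_, fun hp => ?_⟩
  · by_contra! hlt
    obtain ⟨c, hc, hcp⟩ := exists_between hlt
    refine notMem_closure_filmSubgraph ?_ hcp hp
    rw [← nhdsNE_sup_pure, ← nhdsLT_sup_nhdsGT, eventually_sup, eventually_sup, eventually_pure]
    exact ⟨⟨hl.eventually_lt_const ((le_max_left _ _).trans_lt hc),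
      hr.eventually_lt_const ((le_max_right _ _).trans_lt hc)⟩, hmax.trans_lt hc⟩
  · rcases le_max_iff.1 hp with hp | hp
    · exact mem_closure_filmSubgraph (by simp) ha hb hl hp
    · exact mem_closure_filmSubgraph (by simp) ha hb hr hp

lemma mem_interior_closure_filmSubgraph_iff {a b l r : ℝ} {h : ℝ → ℝ}
    {p : EuclideanSpace ℝ (Fin 2)} (ha : a < p 0) (hb : p 0 < b)
    (hl : Tendsto h (𝓝[<] p 0) (𝓝 l)) (hr : Tendsto h (𝓝[>] p 0) (𝓝 r)) :
    p ∈ interior (closure (filmSubgraph a b h)) ↔ p 1 < min l r := by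
  refine ⟨fun hp => lt_min (lt_of_mem_interior_closure_filmSubgraph isOpen_Iio hl hp)
    (lt_of_mem_interior_closure_filmSubgraph isOpen_Ioi hr hp), fun hp => ?_⟩
  obtain ⟨c, hpc, hc⟩ := exists_between hp
  have hev : ∀ᶠ z in 𝓝[≠] p 0, c < h z := by
    rw [← nhdsLT_sup_nhdsGT, eventually_sup]
    exact ⟨hl.eventually_const_lt (hc.trans_le (min_le_left _ _)),
      hr.eventually_const_lt (hc.trans_le (min_le_right _ _))⟩
  rw [mem_interior_iff_mem_nhds]
  filter_upwards [(tendsto_coord p 0).eventually (eventually_nhdsWithin_iff.1 hev),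
    (tendsto_coord p 0).eventually_const_lt ha, (tendsto_coord p 0).eventually_lt_const hb,
    (tendsto_coord p 1).eventually_lt_const hpc] with q hq hqa hqb hqc
  by_cases hne : q 0 = p 0
  · refine mem_closure_filmSubgraph (s := Iio (q 0)) (l := l) (by simp) hqa hqb (by rwa [hne]) ?_
    exact (hqc.trans (hc.trans_le (min_le_left _ _))).le
  · exact subset_closure ⟨hqa, hqb, hqc.trans (hq hne)⟩

lemma LowerSemicontinuousOn.le_of_tendsto {X : Type*} [TopologicalSpace X] {f : X → ℝ} {s : Set X}
    {x : X} {F : Filter X} [F.NeBot] {l : ℝ} (hf : LowerSemicontinuousOn f s) (hx : x ∈ s)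
    (hF : F ≤ 𝓝[s] x) (hl : Tendsto f F (𝓝 l)) : f x ≤ l :=
  le_of_forall_lt_imp_le_of_dense fun c hc =>
    ge_of_tendsto hl (((hf x hx c hc).filter_mono hF).mono fun _ h => h.le)

/-- For `h ∈ AP(a,b)`,
`Γ̃_h = {(x,y) : a < x < b, h⁻(x) ≤ y ≤ h⁺(x)}`. -/
theorem filmGraphTilde_eq
    (a b : ℝ) (hab : a < b) (h : ℝ → ℝ)
    (hlsc : LowerSemicontinuousOn h (Set.Icc a b))
    (hnn : ∀ x ∈ Set.Icc a b, 0 ≤ h x)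
    (hbv : BoundedVariationOn h (Set.Icc a b)) :
    filmGraphTilde a b h
      = {p : EuclideanSpace ℝ (Fin 2) |
          a < p 0 ∧ p 0 < b ∧ hMinus h (p 0) ≤ p 1 ∧ p 1 ≤ hPlus h (p 0)} := by
  ext p
  simp only [filmGraphTilde, filmStrip, mem_inter_iff, mem_ofPred_eq]
  suffices H : a < p 0 → p 0 < b → (p ∈ frontier (closure (filmSubgraph a b h)) ↔
      hMinus h (p 0) ≤ p 1 ∧ p 1 ≤ hPlus h (p 0)) by tauto
  intro ha hb
  have hIcc : Icc a b ∈ 𝓝 (p 0) := Icc_mem_nhds ha hb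
  obtain ⟨l, hl⟩ := hbv.exists_tendsto_left (p 0)
  obtain ⟨r, hr⟩ := hbv.exists_tendsto_right (p 0)
  rw [nhdsWithin_inter_of_mem (mem_nhdsWithin_of_mem_nhds hIcc)] at hl hr
  have hle : h (p 0) ≤ l := hlsc.le_of_tendsto ⟨ha.le, hb.le⟩
    (by rw [nhdsWithin_eq_nhds.2 hIcc]; exact inf_le_left) hl
  rw [hMinus_eq_min hl hr, hPlus_eq_max hl hr, isClosed_closure.frontier_eq, Set.mem_sdiff,
    mem_closure_filmSubgraph_iff_s3 ha hb hl hr (hle.trans (le_max_left _ _)),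
    mem_interior_closure_filmSubgraph_iff ha hb hl hr, not_lt, and_comm]
end
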